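/- Let n be a positive even integer with n ≡ 2 (mod 3) satisfying one of the following conditions: (a) n ≥ 20 and n ≡ 0 (mod 5); (b) n ≥ 206 and n ≡ 1 (mod 5); (c) n ≥ 115 and n ≡ 2 (mod 5); (d) n ≥ 163 and n ≡ 3 (mod 5); (e) n ≥ 235 and n ≡ 4 (mod 5). Then for every finite abelian group H of order n²+n+1 there exist no inverse-closed subsets T₀, T₁ of H with e ∈ T₀ satisfying the APLL group-ring equations. -/

import Mathlib

open scoped Classical Pointwise

/-- The APLL group-ring equations, stated via coefficient counts: for every `h ∈ H`,
`#{(a,b) ∈ T₀×T₁ : ab = h} = 1 − [h = e]`, and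
`#{(a,b) ∈ T₀×T₀ : ab = h} + #{(a,b) ∈ T₁×T₁ : ab = h} + #{t ∈ T₀ : t² = h}
  + #{t ∈ T₁ : t² = h} = 2 + 2n·[h = e]`. -/
def APLLEqs {H : Type*} [CommGroup H] (n : ℕ) (T₀ T₁ : Set H) : Prop :=
  (∀ h : H,
      {p : H × H | p.1 ∈ T₀ ∧ p.2 ∈ T₁ ∧ p.1 * p.2 = h}.ncard
        = if h = 1 then 0 else 1) ∧
  (∀ h : H,
      {p : H × H | p.1 ∈ T₀ ∧ p.2 ∈ T₀ ∧ p.1 * p.2 = h}.ncard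
        + {p : H × H | p.1 ∈ T₁ ∧ p.2 ∈ T₁ ∧ p.1 * p.2 = h}.ncard
        + {t : H | t ∈ T₀ ∧ t ^ 2 = h}.ncard
        + {t : H | t ∈ T₁ ∧ t ^ 2 = h}.ncard
        = 2 + if h = 1 then 2 * n else 0)

/-- `Xset T₀ T₁ i` is the set of `h ∈ H` appearing with coefficient `i` in `T̂⁽²⁾T₀`. -/
def Xset {H : Type*} [CommGroup H] (T₀ T₁ : Set H) (i : ℕ) : Set H :=
  {h : H | {p : H × H | p.1 ∈ T₀ ∪ T₁ ∧ p.2 ∈ T₀ ∧ p.1 ^ 2 * p.2 = h}.ncard = i}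

/-- `Yset T₀ T₁ i` is the set of `h ∈ H` appearing with coefficient `i` in `T̂⁽²⁾T₁`. -/
def Yset {H : Type*} [CommGroup H] (T₀ T₁ : Set H) (i : ℕ) : Set H :=
  {h : H | {p : H × H | p.1 ∈ T₀ ∪ T₁ ∧ p.2 ∈ T₁ ∧ p.1 ^ 2 * p.2 = h}.ncard = i}

/-- `Vset T₀ T₁ i` is the set of `h ∈ H` appearing with coefficient `i` in `T̂⁽⁴⁾T₁`. -/
def Vset {H : Type*} [CommGroup H] (T₀ T₁ : Set H) (i : ℕ) : Set H :=
  {h : H | {p : H × H | p.1 ∈ T₀ ∪ T₁ ∧ p.2 ∈ T₁ ∧ p.1 ^ 4 * p.2 = h}.ncard = i}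

/-- `θ₀ = |(T₀T₀ ∖ T₀⁽²⁾) ∩ T̂⁽⁴⁾|`. -/
noncomputable def theta0 {H : Type*} [CommGroup H] (T₀ T₁ : Set H) : ℕ :=
  (((T₀ * T₀) \ ((fun t => t ^ 2) '' T₀)) ∩ ((fun g => g ^ 4) '' (T₀ ∪ T₁))).ncard

/-- `θ₁ = |T₁ ∩ T̂⁽²⁾|/2 + |(T₁T₁ ∖ (T₁⁽²⁾ ∪ {e})) ∩ T̂⁽⁴⁾|`, as a rational number. -/
noncomputable def theta1 {H : Type*} [CommGroup H] (T₀ T₁ : Set H) : ℚ :=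
  ((T₁ ∩ ((fun g => g ^ 2) '' (T₀ ∪ T₁))).ncard : ℚ) / 2
    + ((((T₁ * T₁) \ (((fun t => t ^ 2) '' T₁) ∪ {1}))
        ∩ ((fun g => g ^ 4) '' (T₀ ∪ T₁))).ncard : ℚ)

/-- `s_i = (i−1)(i−4)/2` if `i ≡ 1 (mod 3)`, and `(i−2)(i−3)/2` otherwise. -/
def sCoef (i : ℕ) : ℚ :=
  if i % 3 = 1 then ((i : ℚ) - 1) * ((i : ℚ) - 4) / 2
  else ((i : ℚ) - 2) * ((i : ℚ) - 3) / 2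

namespace APLL

open Finset MonoidAlgebra

section GroupRing

variable {H : Type*}

/-- The element-sum of a finite set, in the integral group ring. -/
noncomputable def ind (S : Finset H) : MonoidAlgebra ℤ H := ∑ s ∈ S, single s 1

lemma coeff_ind (S : Finset H) (h : H) : (ind S).coeff h = if h ∈ S then 1 else 0 := by
  simp [ind, Finsupp.single_apply, coeff_sum]

variable [CommGroup H]

/-- The ring endomorphism `T ↦ T^{(k)}` of the integral group ring. -/
noncomputable def pw (k : ℕ) : MonoidAlgebra ℤ H →+* MonoidAlgebra ℤ H :=
  mapDomainRingHom ℤ (powMonoidHom k)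

/-- The ring endomorphism induced by inversion. -/
noncomputable def conj : MonoidAlgebra ℤ H →+* MonoidAlgebra ℤ H :=
  mapDomainRingHom ℤ invMonoidHom

/-- The augmentation map. -/
noncomputable def aug : MonoidAlgebra ℤ H →+* ℤ := (lift ℤ ℤ H 1 : MonoidAlgebra ℤ H →ₐ[ℤ] ℤ)

lemma pw_single (k : ℕ) (g : H) (r : ℤ) : pw k (single g r) = single (g ^ k) r := by
  simp [pw]

lemma conj_single (g : H) (r : ℤ) : conj (single g r) = single g⁻¹ r := by
  simp [conj]

lemma aug_single (g : H) (r : ℤ) : aug (single g r) = r := by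
  simp [aug]

lemma aug_ind (S : Finset H) : aug (ind S) = #S := by
  simp [ind, aug_single]

lemma ringHom_ext_single {R : Type*} [Semiring R] {f g : MonoidAlgebra ℤ H →+* R}
    (h : ∀ s : H, f (single s 1) = g (single s 1)) : f = g :=
  MonoidAlgebra.ringHom_ext' (RingHom.ext_int _ _) (by ext s; exact h s)

lemma aug_pw (k : ℕ) (a : MonoidAlgebra ℤ H) : aug (pw k a) = aug a :=
  RingHom.congr_fun (f := aug.comp (pw k)) (g := aug)
    (ringHom_ext_single fun s => by simp [pw_single, aug_single]) a

lemma pw_pw (k l : ℕ) (a : MonoidAlgebra ℤ H) : pw k (pw l a) = pw (l * k) a :=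
  RingHom.congr_fun (f := (pw k).comp (pw l)) (g := pw (l * k))
    (ringHom_ext_single fun s => by simp [pw_single, pow_mul]) a

lemma conj_pw (k : ℕ) (a : MonoidAlgebra ℤ H) : conj (pw k a) = pw k (conj a) :=
  RingHom.congr_fun (f := conj.comp (pw k)) (g := (pw k).comp conj)
    (ringHom_ext_single fun s => by simp [pw_single, conj_single]) a

lemma coeff_pw_ind (k : ℕ) (S : Finset H) (h : H) :
    (pw k (ind S)).coeff h = #{s ∈ S | s ^ k = h} := by
  simp [ind, pw_single, Finsupp.single_apply, coeff_sum]

lemma coeff_pw_ind_nonneg (k : ℕ) (S : Finset H) (h : H) : 0 ≤ (pw k (ind S)).coeff h := by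
  rw [coeff_pw_ind]; positivity

lemma coeff_pw_ind_eq_zero {k : ℕ} {S : Finset H} {h : H} (hh : h ∉ S.image (· ^ k)) :
    (pw k (ind S)).coeff h = 0 := by
  rw [coeff_pw_ind]
  simpa [Finset.filter_eq_empty_iff] using hh

lemma coeff_ind_mul_ind (S T : Finset H) (h : H) :
    (ind S * ind T).coeff h = #{p ∈ S ×ˢ T | p.1 * p.2 = h} := by
  simp [ind, Finset.sum_mul_sum, ← Finset.sum_product', Finsupp.single_apply, coeff_sum,
    single_mul_single]

lemma coeff_intCast_mul (c : ℤ) (a : MonoidAlgebra ℤ H) (h : H) :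
    ((c : MonoidAlgebra ℤ H) * a).coeff h = c * a.coeff h := by
  rw [← zsmul_eq_mul, coeff_smul_apply, smul_eq_mul]

lemma coeff_mul_nonneg {a b : MonoidAlgebra ℤ H} (ha : ∀ h, 0 ≤ a.coeff h)
    (hb : ∀ h, 0 ≤ b.coeff h) (h : H) : 0 ≤ (a * b).coeff h := by
  rw [coeff_mul_apply_left]
  exact Finset.sum_nonneg fun g _ => mul_nonneg (ha _) (hb _)

lemma conj_ind {S : Finset H} (hS : ∀ s ∈ S, s⁻¹ ∈ S) : conj (ind S) = ind S := by
  simp only [ind, map_sum, conj_single]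
  exact Finset.sum_nbij' (·⁻¹) (·⁻¹) hS hS (by simp) (by simp) (by simp)

lemma coeff_inv_of_conj_eq {a : MonoidAlgebra ℤ H} (ha : conj a = a) (h : H) :
    a.coeff h⁻¹ = a.coeff h := by
  conv_lhs => rw [← ha]
  exact Finsupp.mapDomain_apply inv_injective a.coeff h

lemma coeff_pw_one {k : ℕ} (hk : Function.Injective fun h : H => h ^ k)
    (a : MonoidAlgebra ℤ H) : (pw k a).coeff 1 = a.coeff 1 := by
  have := Finsupp.mapDomain_apply hk a.coeff 1
  rwa [one_pow] at this

lemma exists_ind_pow_prime {p : ℕ} (hp : p.Prime) (S : Finset H) :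
    ∃ r, ind S ^ p = pw p (ind S) + p * r := by
  induction S using Finset.induction_on with
  | empty => exact ⟨0, by simp [ind, hp.ne_zero]⟩
  | insert s S hs ih =>
    obtain ⟨r, hr⟩ := ih
    obtain ⟨q, hq⟩ := exists_add_pow_prime_eq hp (single s 1 : MonoidAlgebra ℤ H) (ind S)
    have hi : ind (insert s S) = single s 1 + ind S := Finset.sum_insert hs
    refine ⟨r + single s 1 * ind S * q, ?_⟩
    rw [hi, hq, hr, map_add, pw_single, single_pow, one_pow]
    ring

variable [Fintype H]

lemma aug_eq_sum (a : MonoidAlgebra ℤ H) : aug a = ∑ h, a.coeff h := by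
  rw [aug, RingHom.coe_coe, lift_apply, Finsupp.sum_fintype _ _ (by simp)]
  simp

lemma sum_mul_coeff (a : MonoidAlgebra ℤ H) {b : MonoidAlgebra ℤ H} (hb : conj b = b) :
    ∑ h, a.coeff h * b.coeff h = (a * b).coeff 1 := by
  rw [coeff_mul_apply_left, Finsupp.sum_fintype _ _ (by simp)]
  simp [coeff_inv_of_conj_eq hb]

lemma mul_ind_univ (a : MonoidAlgebra ℤ H) : a * ind univ = (aug a : MonoidAlgebra ℤ H) * ind univ := by
  ext h
  rw [coeff_intCast_mul, coeff_mul_apply_left, Finsupp.sum_fintype _ _ (by simp), aug_eq_sum]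
  simp [coeff_ind]

lemma pw_ind_univ {k : ℕ} (hk : Function.Bijective fun h : H => h ^ k) :
    pw k (ind univ) = (ind univ : MonoidAlgebra ℤ H) := by
  simp only [ind, map_sum, pw_single]
  exact hk.sum_comp fun h => single h (1 : ℤ)

lemma coeff_ind_mul_self_one {S : Finset H} (hS : ∀ s ∈ S, s⁻¹ ∈ S) :
    (ind S * ind S).coeff 1 = #S := by
  rw [← sum_mul_coeff _ (conj_ind hS)]
  simp [coeff_ind]

/-- In a group of odd order, an inverse-closed set containing the identity has odd size. -/
lemma odd_card_of_inv_mem (hH : Odd (Fintype.card H)) {S : Finset H}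
    (hS : ∀ s ∈ S, s⁻¹ ∈ S) (h1 : 1 ∈ S) : Odd #S := by
  have key : ∑ _s ∈ S.erase 1, (1 : ZMod 2) = 0 := by
    refine Finset.sum_involution (fun s _ => s⁻¹) (fun _ _ => by decide) ?_ ?_ (by simp)
    · intro s hs _ hinv
      refine (Finset.mem_erase.1 hs).1 ?_
      have h2 : s ^ 2 = 1 := by rw [pow_two]; nth_rewrite 1 [← hinv]; simp
      have hc : Nat.Coprime 2 (Fintype.card H) := hH.coprime_two_left
      have hd : orderOf s ∣ 1 := hc ▸ Nat.dvd_gcd (orderOf_dvd_of_pow_eq_one h2) orderOf_dvd_card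
      exact orderOf_eq_one_iff.1 (Nat.dvd_one.1 hd)
    · intro s hs
      obtain ⟨hs1, hs⟩ := Finset.mem_erase.1 hs
      exact Finset.mem_erase.2 ⟨by simpa using hs1, hS s hs⟩
  rw [Finset.sum_const, nsmul_one, ZMod.natCast_eq_zero_iff] at key
  rw [← Finset.card_erase_add_one h1]
  exact (even_iff_two_dvd.2 key).add_one

end GroupRing

section Identities

variable {R : Type*} [CommRing R] {n A B E S S' : R}

lemma pow_two_mul_left (h1 : A * B = E - 1) (h2 : A ^ 2 + B ^ 2 = 2 * E - S + 2 * n)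
    (hA : A * E = (n + 1) * E) (hB : B * E = n * E) :
    S * A = (n + 2) * E + 2 * n * A + B - A ^ 3 := by
  linear_combination A * h2 - B * h1 - hB + 2 * hA

lemma pow_two_mul_right (h1 : A * B = E - 1) (h2 : A ^ 2 + B ^ 2 = 2 * E - S + 2 * n)
    (hA : A * E = (n + 1) * E) (hB : B * E = n * E) :
    S * B = (n - 1) * E + 2 * n * B + A - B ^ 3 := by
  linear_combination B * h2 - A * h1 - hA + 2 * hB

lemma pow_four_mul_right (h1 : A * B = E - 1) (h2 : A ^ 2 + B ^ 2 = 2 * E - S + 2 * n)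
    (hA : A * E = (n + 1) * E) (hB : B * E = n * E) (hS : S * E = (2 * n + 1) * E)
    (h4 : S ^ 2 = 4 * E - S' + (2 * n - 2)) :
    S' * B = (n ^ 3 - n ^ 2 + 4 * n + 1) * E + (4 * n ^ 2 + 2 * n - 3) * B + 2 * n * A
      - 4 * n * (S * B) - S * A - B ^ 5 := by
  have hY := pow_two_mul_right h1 h2 hA hB
  linear_combination B * h4 - S * hY + B ^ 2 * hY + 2 * n * hY + B * h1 + 5 * hB
    - (n - 1) * hS + (n - 1) * (B + n) * hB

end Identities

section Forms

lemma neg_six_le_sq_sub (z : ℤ) : -6 ≤ z * z - 5 * z := by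
  rcases le_or_gt z 2 with h | h <;> nlinarith

lemma sq_sub_nonneg_of_five_dvd {z : ℤ} (hz : z % 5 = 0) : 0 ≤ z * z - 5 * z := by
  have : z ≤ 0 ∨ 5 ≤ z := by omega
  rcases this with h | h <;> nlinarith

lemma form_two_nonneg {a b w q : ℤ} (ha : 0 ≤ a) (hb : 0 ≤ b) (hw : 0 ≤ w)
    (hq : w = 2 * a + b + 4 + 5 * q) :
    0 ≤ w + 3 * a ^ 2 + 3 * b ^ 2 - 5 * a * b + b - 4 := by
  by_cases hsmall : a ≤ 1 ∧ b ≤ 1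
  · obtain ⟨ha1, hb1⟩ := hsmall
    interval_cases a <;> interval_cases b <;> omega
  · rcases lt_trichotomy a b with hab | hab | hab
    · have : 2 ≤ b := by omega
      nlinarith
    · subst hab
      have : 2 ≤ a := by omega
      nlinarith
    · have : 2 ≤ a := by omega
      nlinarith

lemma form_three_nonneg {a b w q : ℤ} (ha : 0 ≤ a) (hb : 0 ≤ b) (hw : 0 ≤ w)
    (hq : w = 2 * a - b + 3 + 5 * q) :
    0 ≤ w + 4 * a ^ 2 + 4 * b ^ 2 - 5 * a * b - a - 3 * b - 3 := by
  by_cases hsmall : a ≤ 2 ∧ b ≤ 2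
  · obtain ⟨ha1, hb1⟩ := hsmall
    interval_cases a <;> interval_cases b <;> omega
  · rcases le_or_gt a 2 with hab | hab
    · have : 3 ≤ b := by omega
      nlinarith [sq_nonneg (a - b), sq_nonneg (a - 1)]
    · have : 3 ≤ a := by omega
      nlinarith [sq_nonneg (a - b), sq_nonneg (b - 1)]

end Forms

section Counting

variable {H : Type*} [Fintype H] {x y v : H → ℤ} {n : ℕ} {bad : Finset H}

lemma neg_mul_le_sum {F : H → ℤ} {K : ℤ} (hK : 0 ≤ K) (hbad : (#bad : ℤ) ≤ 5 * n + 2)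
    (hgood : ∀ h ∉ bad, 0 ≤ F h) (hF : ∀ h, -K ≤ F h) : -K * (5 * n + 2) ≤ ∑ h, F h := by
  rw [← Finset.sum_add_sum_compl bad]
  have h1 : #bad • (-K) ≤ ∑ h ∈ bad, F h := Finset.card_nsmul_le_sum _ _ _ fun h _ => hF h
  have h2 : 0 ≤ ∑ h ∈ badᶜ, F h :=
    Finset.sum_nonneg fun h hh => hgood h (Finset.mem_compl.1 hh)
  rw [nsmul_eq_mul] at h1
  nlinarith

/-- The moment conditions contradict each other: in every residue class of `n` modulo `5`, some
quadratic form in `v`, `x`, `y` has negative sum although it is nonnegative outside `bad`. -/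
lemma false_of_moments (hcases : (20 ≤ n ∧ n % 5 = 0) ∨ (206 ≤ n ∧ n % 5 = 1)
      ∨ (115 ≤ n ∧ n % 5 = 2) ∨ (163 ≤ n ∧ n % 5 = 3) ∨ (235 ≤ n ∧ n % 5 = 4))
    (hN : (Fintype.card H : ℤ) = n ^ 2 + n + 1)
    (hx0 : ∀ h, 0 ≤ x h) (hy0 : ∀ h, 0 ≤ y h) (hv0 : ∀ h, 0 ≤ v h)
    (hx : ∑ h, x h = (2 * n + 1) * (n + 1)) (hy : ∑ h, y h = (2 * n + 1) * n)
    (hv : ∑ h, v h = (2 * n + 1) * n)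
    (hxx : ∑ h, x h * x h ≤ 4 * (n + 1) ^ 2 + (2 * n - 2) * (n + 1))
    (hyy : ∑ h, y h * y h ≤ 4 * n ^ 2 + (2 * n - 2) * n)
    (hvv : ∑ h, v h * v h ≤ 4 * n ^ 2 + (2 * n - 2) * n)
    (hxy : ∑ h, x h * y h = (2 * n + 1) ^ 2 - (2 * n + 1))
    (hbad : (#bad : ℤ) ≤ 5 * n + 2)
    (hx3 : ∀ h ∉ bad, x h % 3 = 1) (hy3 : ∀ h ∉ bad, y h % 3 = 1)
    (hv5 : ∀ h ∉ bad, ∃ r : ℤ,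
      v h = n ^ 3 - n ^ 2 + 4 * n + 1 - 4 * n * y h - x h - 5 * r) : False := by
  have expand (a b c d e f g k : ℤ) :
      ∑ h, (a * (v h * v h) + b * v h + c * (x h * x h) + d * (x h * y h) + e * (y h * y h)
        + f * x h + g * y h + k) =
      a * ∑ h, v h * v h + b * ∑ h, v h + c * ∑ h, x h * x h + d * ∑ h, x h * y h
        + e * ∑ h, y h * y h + f * ∑ h, x h + g * ∑ h, y h + k * (n ^ 2 + n + 1) := by
    simp only [Finset.sum_add_distrib, ← Finset.mul_sum, Finset.sum_const, nsmul_eq_mul, ← hN,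
      Finset.card_univ]
    ring
  have residue (c : ℤ) (hc : (n : ℤ) % 5 = c) (h : H) (hh : h ∉ bad) :
      ∃ q : ℤ, v h = c ^ 3 - c ^ 2 + 4 * c + 1 + c * y h - x h + 5 * q := by
    obtain ⟨r, hr⟩ := hv5 h hh
    obtain ⟨m, hm⟩ : ∃ m : ℤ, (n : ℤ) = 5 * m + c := ⟨n / 5, by omega⟩
    refine ⟨25 * m ^ 3 + 15 * m ^ 2 * c + 3 * m * c ^ 2 - 5 * m ^ 2 - 2 * m * c + 4 * m
      - 4 * m * y h - c * y h - r, ?_⟩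
    rw [hr, hm]
    ring
  have param (h : H) (hh : h ∉ bad) :
      ∃ a b : ℤ, 0 ≤ a ∧ 0 ≤ b ∧ x h = 3 * a + 1 ∧ y h = 3 * b + 1 := by
    have := hx0 h
    have := hy0 h
    have := hx3 h hh
    have := hy3 h hh
    exact ⟨x h / 3, y h / 3, by omega, by omega, by omega, by omega⟩
  rcases hcases with ⟨hn, hr⟩ | ⟨hn, hr⟩ | ⟨hn, hr⟩ | ⟨hn, hr⟩ | ⟨hn, hr⟩
  · have h1 := neg_mul_le_sum (K := 8) (by norm_num) hbad
      (F := fun h => 1 * (v h * v h) + (-5) * v h + 0 * (x h * x h) + 0 * (x h * y h)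
        + 0 * (y h * y h) + 2 * x h + 0 * y h + (-2))
      (fun h hh => by
        obtain ⟨q, hq⟩ := residue 0 (by omega) h hh
        obtain ⟨a, b, ha, hb, hxa, hyb⟩ := param h hh
        rcases ha.eq_or_lt with ha | ha
        · have := sq_sub_nonneg_of_five_dvd (z := v h) (by omega)
          linarith
        · have := neg_six_le_sq_sub (v h)
          linarith)
      (fun h => by
        have := neg_six_le_sq_sub (v h)
        have := hx0 h
        linarith)
    rw [expand] at h1
    have hn' : (20 : ℤ) * n ≤ n ^ 2 := by exact_mod_cast pow_two n ▸ Nat.mul_le_mul_right n hn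
    linarith
  · have h1 := neg_mul_le_sum (K := 18) (by norm_num) hbad
      (F := fun h => 3 * (v h * v h) + (-15) * v h + 2 * (x h * x h) + (-4) * (x h * y h)
        + 2 * (y h * y h) + 0 * x h + 0 * y h + 0)
      (fun h hh => by
        obtain ⟨q, hq⟩ := residue 1 (by omega) h hh
        obtain ⟨a, b, ha, hb, hxa, hyb⟩ := param h hh
        have h18 : x h = y h ∨ 9 ≤ (x h - y h) * (x h - y h) := by
          rcases lt_trichotomy a b with hab | hab | hab
          · right; nlinarith
          · left; omega
          · right; nlinarith
        rcases h18 with hxy | h18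
        · have := sq_sub_nonneg_of_five_dvd (z := v h) (by omega)
          rw [hxy]
          linarith
        · have := neg_six_le_sq_sub (v h)
          linarith)
      (fun h => by
        have := neg_six_le_sq_sub (v h)
        nlinarith [sq_nonneg (x h - y h)])
    rw [expand] at h1
    have hn' : (206 : ℤ) * n ≤ n ^ 2 := by exact_mod_cast pow_two n ▸ Nat.mul_le_mul_right n hn
    linarith
  · have h1 := neg_mul_le_sum (K := 39) (by norm_num) hbad
      (F := fun h => 0 * (v h * v h) + 9 * v h + 3 * (x h * x h) + (-5) * (x h * y h)
        + 3 * (y h * y h) + (-1) * x h + 2 * y h + (-38))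
      (fun h hh => by
        obtain ⟨q, hq⟩ := residue 2 (by omega) h hh
        obtain ⟨a, b, ha, hb, hxa, hyb⟩ := param h hh
        have hvh := hv0 h
        rw [hxa, hyb]
        linarith [form_two_nonneg ha hb hvh (q := q + b - a + 2) (by omega)])
      (fun h => by
        have := hv0 h
        nlinarith [sq_nonneg (6 * x h - 5 * y h - 1), sq_nonneg (11 * y h + 7)])
    rw [expand] at h1
    have hn' : (115 : ℤ) * n ≤ n ^ 2 := by exact_mod_cast pow_two n ▸ Nat.mul_le_mul_right n hn
    linarith
  · have h1 := neg_mul_le_sum (K := 40) (by norm_num) hbad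
      (F := fun h => 0 * (v h * v h) + 9 * v h + 4 * (x h * x h) + (-5) * (x h * y h)
        + 4 * (y h * y h) + (-6) * x h + (-12) * y h + (-12))
      (fun h hh => by
        obtain ⟨q, hq⟩ := residue 3 (by omega) h hh
        obtain ⟨a, b, ha, hb, hxa, hyb⟩ := param h hh
        have hvh := hv0 h
        rw [hxa, hyb]
        linarith [form_three_nonneg ha hb hvh (q := q + 2 * b - a + 6) (by omega)])
      (fun h => by
        have := hv0 h
        nlinarith [sq_nonneg (8 * x h - 5 * y h - 6), sq_nonneg (39 * y h - 126)])
    rw [expand] at h1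
    have hn' : (163 : ℤ) * n ≤ n ^ 2 := by exact_mod_cast pow_two n ▸ Nat.mul_le_mul_right n hn
    linarith
  · have h1 := neg_mul_le_sum (K := 18) (by norm_num) hbad
      (F := fun h => 3 * (v h * v h) + (-15) * v h + 2 * (x h * x h) + 4 * (x h * y h)
        + 2 * (y h * y h) + (-20) * x h + (-20) * y h + 50)
      (fun h hh => by
        obtain ⟨q, hq⟩ := residue 4 (by omega) h hh
        obtain ⟨a, b, ha, hb, hxa, hyb⟩ := param h hh
        have h18 : x h = 5 - y h ∨ 9 ≤ (x h + y h - 5) * (x h + y h - 5) := by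
          rcases lt_trichotomy (a + b) 1 with hab | hab | hab
          · right; nlinarith
          · left; omega
          · right; nlinarith
        rcases h18 with hxy | h18
        · have := sq_sub_nonneg_of_five_dvd (z := v h) (by omega)
          rw [hxy]
          linarith
        · have := neg_six_le_sq_sub (v h)
          linarith)
      (fun h => by
        have := neg_six_le_sq_sub (v h)
        nlinarith [sq_nonneg (x h + y h - 5)])
    rw [expand] at h1
    have hn' : (235 : ℤ) * n ≤ n ^ 2 := by exact_mod_cast pow_two n ▸ Nat.mul_le_mul_right n hn
    linarith

end Counting

section Main

variable {H : Type*} [CommGroup H] [Fintype H] {n : ℕ} {S₀ S₁ : Finset H}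

lemma ind_mul_ind_of_APLLEqs (h : APLLEqs n (S₀ : Set H) S₁) :
    ind S₀ * ind S₁ = ind univ - 1 := by
  ext g
  have hg := h.1 g
  have hset : {p : H × H | p.1 ∈ (S₀ : Set H) ∧ p.2 ∈ (S₁ : Set H) ∧ p.1 * p.2 = g} =
      ({p ∈ S₀ ×ˢ S₁ | p.1 * p.2 = g} : Finset (H × H)) := by
    ext p; simp [and_assoc]
  rw [hset, Set.ncard_coe_finset] at hg
  rw [coeff_ind_mul_ind, hg, coeff_sub, Finsupp.sub_apply, coeff_ind, one_def, coeff_single,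
    Finsupp.single_apply]
  by_cases hg1 : g = 1
  · simp [hg1]
  · simp [hg1, Ne.symm hg1]

lemma ind_sq_add_ind_sq_of_APLLEqs (h : APLLEqs n (S₀ : Set H) S₁) :
    ind S₀ ^ 2 + ind S₁ ^ 2 =
      2 * ind univ - (pw 2 (ind S₀) + pw 2 (ind S₁)) + 2 * (n : MonoidAlgebra ℤ H) := by
  ext g
  have hg := h.2 g
  have hset (S : Finset H) :
      {p : H × H | p.1 ∈ (S : Set H) ∧ p.2 ∈ (S : Set H) ∧ p.1 * p.2 = g} =
        ({p ∈ S ×ˢ S | p.1 * p.2 = g} : Finset (H × H)) := by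
    ext p; simp [and_assoc]
  have hset' (S : Finset H) :
      {t : H | t ∈ (S : Set H) ∧ t ^ 2 = g} = ({t ∈ S | t ^ 2 = g} : Finset H) := by
    ext p; simp
  rw [hset, hset, hset', hset', Set.ncard_coe_finset, Set.ncard_coe_finset,
    Set.ncard_coe_finset, Set.ncard_coe_finset] at hg
  have hn : 2 * (n : MonoidAlgebra ℤ H) =
      ((2 * n : ℤ) : MonoidAlgebra ℤ H) * single 1 1 := by
    rw [← one_def]; push_cast; ring
  rw [hn, pow_two, pow_two, two_mul]
  simp only [coeff_add, coeff_sub, Finsupp.add_apply, Finsupp.sub_apply, coeff_intCast_mul,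
    coeff_ind_mul_ind, coeff_pw_ind, coeff_ind, coeff_single, Finsupp.single_apply]
  by_cases hg1 : g = 1
  · subst hg1
    simp at hg ⊢
    omega
  · simp [hg1, Ne.symm hg1] at hg ⊢
    omega

/-- `T₀` and `T₁` have `n + 1` and `n` elements when `n` is even. -/
lemma card_eq_of_APLLEqs (heven : Even n) (hcard : Fintype.card H = n ^ 2 + n + 1)
    (h₀ : ∀ s ∈ S₀, s⁻¹ ∈ S₀) (h1 : 1 ∈ S₀) (h : APLLEqs n (S₀ : Set H) S₁) :
    #S₀ = n + 1 ∧ #S₁ = n := by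
  have e1 := congrArg aug (ind_mul_ind_of_APLLEqs h)
  have e2 := congrArg aug (ind_sq_add_ind_sq_of_APLLEqs h)
  simp only [map_mul, map_sub, map_add, map_pow, map_one, map_natCast, map_ofNat, aug_ind, aug_pw,
    Finset.card_univ, hcard] at e1 e2
  push_cast at e1 e2
  have hodd : Odd #S₀ := by
    refine odd_card_of_inv_mem ?_ h₀ h1
    rw [hcard, pow_two]
    exact ((heven.mul_right n).add heven).add_one
  have hsum : (#S₀ : ℤ) + #S₁ = 2 * n + 1 := by
    have : ((#S₀ : ℤ) + #S₁ - (2 * n + 1)) * (#S₀ + #S₁ + 2 * n + 2) = 0 := by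
      linear_combination e2 + 2 * e1
    rcases mul_eq_zero.1 this with h | h <;> omega
  have hprod : ((#S₀ : ℤ) - n) * (#S₀ - (n + 1)) = 0 := by
    linear_combination -e1 + (#S₀ : ℤ) * hsum
  obtain ⟨k, hk⟩ := hodd
  obtain ⟨l, hl⟩ := heven
  rcases mul_eq_zero.1 hprod with h | h <;> omega

/-- A second moment bound for `S * ind T`, where `S² = 4H - S' + 2n - 2` with `S'` nonnegative. -/
lemma sum_sq_coeff_le {S S' : MonoidAlgebra ℤ H} {T : Finset H} (hT : ∀ t ∈ T, t⁻¹ ∈ T)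
    (hS : conj S = S) (hS' : ∀ h, 0 ≤ S'.coeff h)
    (h4 : S ^ 2 = 4 * ind univ - S' + (2 * (n : MonoidAlgebra ℤ H) - 2)) :
    ∑ h, (S * ind T).coeff h * (S * ind T).coeff h ≤ 4 * #T ^ 2 + (2 * n - 2) * #T := by
  have hc : conj (S * ind T) = S * ind T := by rw [map_mul, hS, conj_ind hT]
  have hE : ind T * ind T * ind univ = ((#T ^ 2 : ℤ) : MonoidAlgebra ℤ H) * ind univ := by
    rw [mul_ind_univ, map_mul, aug_ind, pow_two]
  have e : S * ind T * (S * ind T) =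
      ((4 * #T ^ 2 : ℤ) : MonoidAlgebra ℤ H) * ind univ - S' * (ind T * ind T)
        + ((2 * n - 2 : ℤ) : MonoidAlgebra ℤ H) * (ind T * ind T) := by
    push_cast at hE ⊢
    linear_combination ind T ^ 2 * h4 + 4 * hE
  have hnn : 0 ≤ (S' * (ind T * ind T)).coeff 1 := by
    refine coeff_mul_nonneg hS' (coeff_mul_nonneg ?_ ?_) 1 <;>
      (intro h; rw [coeff_ind]; split_ifs <;> norm_num)
  rw [sum_mul_coeff _ hc, e]
  simp only [coeff_add, coeff_sub, Finsupp.add_apply, Finsupp.sub_apply, coeff_intCast_mul,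
    coeff_ind_mul_self_one hT, coeff_ind, Finset.mem_univ, if_true]
  linarith

theorem not_APLLEqs_of_finset (heven : Even n) (h3 : n % 3 = 2)
    (hcases : (20 ≤ n ∧ n % 5 = 0) ∨ (206 ≤ n ∧ n % 5 = 1) ∨ (115 ≤ n ∧ n % 5 = 2)
      ∨ (163 ≤ n ∧ n % 5 = 3) ∨ (235 ≤ n ∧ n % 5 = 4))
    (hcard : Fintype.card H = n ^ 2 + n + 1)
    (h₀ : ∀ s ∈ S₀, s⁻¹ ∈ S₀) (h₁ : ∀ s ∈ S₁, s⁻¹ ∈ S₁) (hone : 1 ∈ S₀) :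
    ¬ APLLEqs n (S₀ : Set H) S₁ := by
  intro h
  obtain ⟨c₀, c₁⟩ := card_eq_of_APLLEqs heven hcard h₀ hone h
  have h1 := ind_mul_ind_of_APLLEqs h
  have h2 := ind_sq_add_ind_sq_of_APLLEqs h
  have hbij : Function.Bijective fun g : H => g ^ 2 := by
    refine (powCoprime ?_).bijective
    rw [Nat.card_eq_fintype_card, hcard, pow_two]
    exact (((heven.mul_right n).add heven).add_one).coprime_two_right
  set A := ind S₀ with hAdef
  set B := ind S₁ with hBdef
  set E : MonoidAlgebra ℤ H := ind univ with hEdef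
  have augA : aug A = n + 1 := by rw [aug_ind, c₀]; push_cast; rfl
  have augB : aug B = n := by rw [aug_ind, c₁]
  have hA : A * E = (n + 1) * E := by rw [mul_ind_univ, augA]; push_cast; rfl
  have hB : B * E = n * E := by rw [mul_ind_univ, augB]; push_cast; rfl
  have hAB : (A + B) ^ 2 = 4 * E - pw 2 (A + B) + (2 * n - 2) := by
    rw [map_add]
    linear_combination h2 + 2 * h1
  have lift2 {P Q : MonoidAlgebra ℤ H} (hPQ : P ^ 2 = 4 * E - Q + (2 * n - 2)) :
      pw 2 P ^ 2 = 4 * E - pw 2 Q + (2 * n - 2) := by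
    have := congrArg (pw 2) hPQ
    rwa [map_pow, map_add, map_sub, map_sub, map_mul, map_mul, map_ofNat, map_ofNat, map_natCast,
      hEdef, pw_ind_univ hbij] at this
  have h4 := lift2 hAB
  have h8 := lift2 h4
  have conjAB : conj (A + B) = A + B := by rw [map_add, conj_ind h₀, conj_ind h₁]
  have nonneg (k : ℕ) (g : H) : 0 ≤ (pw k (A + B)).coeff g := by
    rw [map_add, coeff_add, Finsupp.add_apply]
    exact add_nonneg (coeff_pw_ind_nonneg ..) (coeff_pw_ind_nonneg ..)
  have ind_nonneg (S : Finset H) (g : H) : 0 ≤ (ind S).coeff g := by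
    rw [coeff_ind]; split_ifs <;> norm_num
  set P := pw 2 (A + B) with hP
  set Q := pw 2 P with hQ
  have hQ4 : Q = pw 4 (A + B) := by rw [hQ, hP, pw_pw]
  have hQ8 : pw 2 Q = pw 8 (A + B) := by rw [hQ4, pw_pw]
  have conjP : conj P = P := by rw [hP, conj_pw, conjAB]
  have conjQ : conj Q = Q := by rw [hQ, conj_pw, conjP]
  have augP : aug P = 2 * n + 1 := by rw [hP, aug_pw, map_add, augA, augB]; ring
  have augQ : aug Q = 2 * n + 1 := by rw [hQ, aug_pw, augP]
  have hPE : P * E = (2 * n + 1) * E := by rw [mul_ind_univ, augP]; push_cast; rfl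
  have h2' : A ^ 2 + B ^ 2 = 2 * E - P + 2 * n := by rw [h2, hP, map_add]
  have hX := pow_two_mul_left h1 h2' hA hB
  have hY := pow_two_mul_right h1 h2' hA hB
  have hV := pow_four_mul_right h1 h2' hA hB hPE h4
  obtain ⟨r₀, hr₀⟩ := exists_ind_pow_prime Nat.prime_three S₀
  obtain ⟨r₁, hr₁⟩ := exists_ind_pow_prime Nat.prime_three S₁
  obtain ⟨r, hr⟩ := exists_ind_pow_prime Nat.prime_five S₁
  have hX' : P * A = ((n + 2 : ℤ) : MonoidAlgebra ℤ H) * E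
      + ((2 * n : ℤ) : MonoidAlgebra ℤ H) * A + B
      - (pw 3 A + ((3 : ℤ) : MonoidAlgebra ℤ H) * r₀) := by
    rw [hX, hr₀]; push_cast; ring
  have hY' : P * B = ((n - 1 : ℤ) : MonoidAlgebra ℤ H) * E
      + ((2 * n : ℤ) : MonoidAlgebra ℤ H) * B + A
      - (pw 3 B + ((3 : ℤ) : MonoidAlgebra ℤ H) * r₁) := by
    rw [hY, hr₁]; push_cast; ring
  have hV' : Q * B = ((n ^ 3 - n ^ 2 + 4 * n + 1 : ℤ) : MonoidAlgebra ℤ H) * E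
      + ((4 * n ^ 2 + 2 * n - 3 : ℤ) : MonoidAlgebra ℤ H) * B
      + ((2 * n : ℤ) : MonoidAlgebra ℤ H) * A
      - ((4 * n : ℤ) : MonoidAlgebra ℤ H) * (P * B) - P * A
      - (pw 5 B + ((5 : ℤ) : MonoidAlgebra ℤ H) * r) := by
    rw [hV, hr]; push_cast; ring
  let bad : Finset H := (S₀ ∪ S₁) ∪ (S₀ ∪ S₁).image (· ^ 3) ∪ S₁.image (· ^ 5)
  have hbad : (#bad : ℤ) ≤ 5 * n + 2 := by
    have u1 := card_union_le ((S₀ ∪ S₁) ∪ (S₀ ∪ S₁).image (· ^ 3)) (S₁.image (· ^ 5))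
    have u2 := card_union_le (S₀ ∪ S₁) ((S₀ ∪ S₁).image (· ^ 3))
    have u3 := card_union_le S₀ S₁
    have u4 := card_image_le (s := S₀ ∪ S₁) (f := (· ^ 3))
    have u5 := card_image_le (s := S₁) (f := (· ^ 5))
    have : #bad ≤ 5 * n + 2 := by
      change #((S₀ ∪ S₁) ∪ (S₀ ∪ S₁).image (· ^ 3) ∪ S₁.image (· ^ 5)) ≤ _
      omega
    exact_mod_cast this
  have off (g : H) (hg : g ∉ bad) : A.coeff g = 0 ∧ B.coeff g = 0 ∧ (pw 3 A).coeff g = 0 ∧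
      (pw 3 B).coeff g = 0 ∧ (pw 5 B).coeff g = 0 := by
    simp only [bad, image_union, Finset.mem_union, not_or] at hg
    obtain ⟨⟨⟨g1, g2⟩, g3, g4⟩, g5⟩ := hg
    refine ⟨?_, ?_, coeff_pw_ind_eq_zero g3, coeff_pw_ind_eq_zero g4, coeff_pw_ind_eq_zero g5⟩
    · rw [coeff_ind, if_neg g1]
    · rw [coeff_ind, if_neg g2]
  have coeffE (g : H) : E.coeff g = 1 := by rw [coeff_ind, if_pos (Finset.mem_univ g)]
  have hPP : (P * P).coeff 1 = 2 * n + 1 := by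
    rw [hP, ← map_mul, coeff_pw_one hbij.injective,
      show (A + B) * (A + B) = A * A + B * B + (A * B + A * B) by ring, h1]
    simp only [coeff_add, coeff_sub, Finsupp.add_apply, Finsupp.sub_apply,
      coeff_ind_mul_self_one h₀, coeff_ind_mul_self_one h₁, coeffE, c₀, c₁, hAdef, hBdef]
    simp [one_def]
    ring
  refine false_of_moments (x := (P * A).coeff) (y := (P * B).coeff) (v := (Q * B).coeff)
    (bad := bad) hcases (by rw [hcard]; push_cast; rfl)
    (coeff_mul_nonneg (nonneg 2) (ind_nonneg _)) (coeff_mul_nonneg (nonneg 2) (ind_nonneg _))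
    (coeff_mul_nonneg (hQ4 ▸ nonneg 4) (ind_nonneg _)) ?_ ?_ ?_ ?_ ?_ ?_ ?_ hbad ?_ ?_ ?_
  · rw [← aug_eq_sum, map_mul, augP, augA]
  · rw [← aug_eq_sum, map_mul, augP, augB]
  · rw [← aug_eq_sum, map_mul, augQ, augB]
  · refine (sum_sq_coeff_le h₀ conjP (hQ4 ▸ nonneg 4) h4).trans_eq ?_
    rw [c₀]; push_cast; ring
  · refine (sum_sq_coeff_le h₁ conjP (hQ4 ▸ nonneg 4) h4).trans_eq ?_
    rw [c₁]
  · refine (sum_sq_coeff_le h₁ conjQ (hQ8 ▸ nonneg 8) h8).trans_eq ?_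
    rw [c₁]
  · rw [sum_mul_coeff _ (by rw [map_mul, conjP, conj_ind h₁]),
      show P * A * (P * B) = (((2 * n + 1) ^ 2 : ℤ) : MonoidAlgebra ℤ H) * E - P * P by
        push_cast
        linear_combination P ^ 2 * h1 + (P + (2 * n + 1)) * hPE]
    rw [coeff_sub, Finsupp.sub_apply, coeff_intCast_mul, coeffE, hPP]
    ring
  · intro g hg
    obtain ⟨gA, gB, gA3, gB3, gB5⟩ := off g hg
    rw [hX']
    simp only [coeff_add, coeff_sub, Finsupp.add_apply, Finsupp.sub_apply, coeff_intCast_mul,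
      gA, gB, gA3, coeffE]
    omega
  · intro g hg
    obtain ⟨gA, gB, gA3, gB3, gB5⟩ := off g hg
    rw [hY']
    simp only [coeff_add, coeff_sub, Finsupp.add_apply, Finsupp.sub_apply, coeff_intCast_mul,
      gA, gB, gB3, coeffE]
    omega
  · intro g hg
    obtain ⟨gA, gB, gA3, gB3, gB5⟩ := off g hg
    refine ⟨r.coeff g, ?_⟩
    rw [hV']
    simp only [coeff_add, coeff_sub, Finsupp.add_apply, Finsupp.sub_apply, coeff_intCast_mul,
      gA, gB, gB5, coeffE]
    ring

end Main

end APLL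

/-- Nonexistence of inverse-closed subsets `T₀, T₁` with `e ∈ T₀` satisfying the
APLL group-ring equations, in any finite abelian group of order `n²+n+1`. -/
theorem no_APLL_subsets_even_2mod3 (n : ℕ) (hn : 0 < n)
    (heven : Even n) (h3 : n % 3 = 2)
    (hcases : (20 ≤ n ∧ n % 5 = 0) ∨ (206 ≤ n ∧ n % 5 = 1) ∨ (115 ≤ n ∧ n % 5 = 2)
      ∨ (163 ≤ n ∧ n % 5 = 3) ∨ (235 ≤ n ∧ n % 5 = 4))
    (H : Type*) [CommGroup H] [Fintype H]
    (hcard : Fintype.card H = n ^ 2 + n + 1) :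
    ¬ ∃ T₀ T₁ : Set H,
        T₀⁻¹ = T₀ ∧ T₁⁻¹ = T₁ ∧ (1 : H) ∈ T₀ ∧ APLLEqs n T₀ T₁ := by
  rintro ⟨T₀, T₁, h₀, h₁, hone, h⟩
  refine APLL.not_APLLEqs_of_finset (S₀ := T₀.toFinset) (S₁ := T₁.toFinset) heven h3 hcases hcard
    (fun s hs => ?_) (fun s hs => ?_) (by simpa using hone) (by simpa using h)
  · rw [Set.mem_toFinset] at hs ⊢
    rwa [← Set.mem_inv, h₀]
  · rw [Set.mem_toFinset] at hs ⊢
    rwa [← Set.mem_inv, h₁]
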